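/- arXiv:2006.10108 — 3 statements merged into one kernel-verified Lean document; each statement's English description precedes it below -/
import Mathlib

section
/- Let K ≥ 1 and let ψ : ℝ → ℝ be differentiable and strictly convex on the interval [0, 1]. For a forecast f in the probability simplex Δ_K and a true distribution t ∈ Δ_K, define the (expected, separable) Bregman score s_ψ(f, t) = ∑_{k=1}^K [(f_k − t_k)·ψ'(f_k) − ψ(f_k)], and define the worst-case Bregman risk W(f) = sup_{t ∈ Δ_K} s_ψ(f, t) = max_{k} [∑_{j=1}^K (f_j·ψ'(f_j) − ψ(f_j)) − ψ'(f_k)]. Then for every f ∈ Δ_K one has W(f) ≥ −K·ψ(1/K), with equality if and only if f is the uniform distribution f_k = 1/K for all k. Consequently, the uniform distribution is the unique solution of the minimax problem inf_{f ∈ Δ_K} sup_{t ∈ Δ_K} s_ψ(f, t). -/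
open Finset

theorem bregman_grad_lt (ψ dψ : ℝ → ℝ)
    (hdiff : ∀ x ∈ Set.Icc (0:ℝ) 1, HasDerivWithinAt ψ (dψ x) (Set.Icc (0:ℝ) 1) x)
    (hconv : StrictConvexOn ℝ (Set.Icc (0:ℝ) 1) ψ) (x u : ℝ)
    (hx : x ∈ Set.Icc (0:ℝ) 1) (hu : u ∈ Set.Icc (0:ℝ) 1) (hne : x ≠ u) :
    -ψ u < (x - u) * dψ x - ψ x := by
  rcases lt_or_gt_of_ne hne with h | h
  · have h1 := hconv.lt_slope_of_hasDerivWithinAt hx hu h (hdiff x hx)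
    rw [slope_def_field, lt_div_iff₀ (by linarith)] at h1
    linarith
  · have h1 := hconv.slope_lt_of_hasDerivWithinAt hu hx h (hdiff x hx)
    rw [slope_def_field, div_lt_iff₀ (by linarith)] at h1
    linarith

/-- **Lemma 1 (uniform distribution is minimax optimal for the Bregman score).**
Let `K ≥ 1` and `ψ : ℝ → ℝ` be differentiable (with derivative `dψ`) and strictly convex
on `[0,1]`. For `f, t` in the probability simplex `Δ_K`, the separable Bregman score is
`s f t = ∑ k, ((f k - t k) * dψ (f k) - ψ (f k))`, and the worst-case Bregman risk is
`W f = sup_{t ∈ Δ_K} s f t`. Then for every `f ∈ Δ_K`: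
`W f = max_k [∑ j, (f j * dψ (f j) - ψ (f j)) - dψ (f k)]`, moreover
`W f ≥ -K * ψ (1/K)` with equality iff `f` is the uniform distribution; consequently the
uniform distribution is the unique solution of the minimax problem `inf_f sup_t s f t`. -/
theorem uniform_minimax_bregman
    (K : ℕ) (hK : 1 ≤ K) (ψ dψ : ℝ → ℝ)
    (hdiff : ∀ x ∈ Set.Icc (0:ℝ) 1, HasDerivWithinAt ψ (dψ x) (Set.Icc (0:ℝ) 1) x)
    (hconv : StrictConvexOn ℝ (Set.Icc (0:ℝ) 1) ψ)
    (s : (Fin K → ℝ) → (Fin K → ℝ) → ℝ)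
    (hs : ∀ f t, s f t = ∑ k, ((f k - t k) * dψ (f k) - ψ (f k)))
    (W : (Fin K → ℝ) → ℝ)
    (hW : ∀ f, W f =
      sSup {r | ∃ t : Fin K → ℝ, (∀ k, 0 ≤ t k) ∧ ∑ k, t k = 1 ∧ r = s f t}) :
    ∀ f : Fin K → ℝ, (∀ k, 0 ≤ f k) → ∑ k, f k = 1 →
      (W f = Finset.univ.sup' ⟨⟨0, hK⟩, Finset.mem_univ _⟩
          (fun k => (∑ j, (f j * dψ (f j) - ψ (f j))) - dψ (f k))) ∧
      (-(K : ℝ) * ψ (1 / K) ≤ W f) ∧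
      (W f = -(K : ℝ) * ψ (1 / K) ↔ f = fun _ => 1 / (K : ℝ)) := by
  intro f hf0 hf1
  have hKpos : (0:ℝ) < K := by exact_mod_cast hK
  have hK1 : (1:ℝ) ≤ K := by exact_mod_cast hK
  have hs' : ∀ t : Fin K → ℝ, ∑ k, t k = 1 →
      s f t = ∑ k, t k * ((∑ j, (f j * dψ (f j) - ψ (f j))) - dψ (f k)) := by
    intro t ht
    rw [hs]
    simp only [mul_sub, Finset.sum_sub_distrib, sub_mul]
    rw [← Finset.sum_mul, ← Finset.sum_mul, ht]
    ring
  have hlub : IsLUB {r | ∃ t : Fin K → ℝ, (∀ k, 0 ≤ t k) ∧ ∑ k, t k = 1 ∧ r = s f t}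
      (Finset.univ.sup' ⟨⟨0, hK⟩, Finset.mem_univ _⟩
          (fun k => (∑ j, (f j * dψ (f j) - ψ (f j))) - dψ (f k))) := by
    constructor
    · rintro r ⟨t, ht0, ht1, rfl⟩
      rw [hs' t ht1]
      set M := Finset.univ.sup' ⟨⟨0, hK⟩, Finset.mem_univ _⟩
          (fun k => (∑ j, (f j * dψ (f j) - ψ (f j))) - dψ (f k)) with hM
      calc _ ≤ ∑ k, t k * M := by
            apply Finset.sum_le_sum
            intro k _
            apply mul_le_mul_of_nonneg_left _ (ht0 k)
            exact Finset.le_sup' (fun k => (∑ j, (f j * dψ (f j) - ψ (f j))) - dψ (f k))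
              (Finset.mem_univ k)
        _ = M := by rw [← Finset.sum_mul, ht1, one_mul]
    · intro b hb
      apply Finset.sup'_le
      intro k _
      apply hb
      refine ⟨Pi.single k 1, ?_, by simp, ?_⟩
      · intro j
        by_cases h : j = k
        · subst h; simp
        · simp [h]
      · rw [hs' _ (by simp)]
        simp [Pi.single_apply]
  have hWlub : IsLUB {r | ∃ t : Fin K → ℝ, (∀ k, 0 ≤ t k) ∧ ∑ k, t k = 1 ∧ r = s f t} (W f) := by
    rw [hW f, hlub.csSup_eq ⟨_, f, hf0, hf1, rfl⟩]
    exact hlub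
  have hu0 : (0:ℝ) ≤ 1 / K := by positivity
  have hu : (1:ℝ) / K ∈ Set.Icc (0:ℝ) 1 := ⟨hu0, by rw [div_le_one hKpos]; exact hK1⟩
  have husum : ∑ _k : Fin K, (1:ℝ) / K = 1 := by
    simp [hKpos.ne']
  have hfI : ∀ k, f k ∈ Set.Icc (0:ℝ) 1 := fun k =>
    ⟨hf0 k, hf1 ▸ Finset.single_le_sum (fun j _ => hf0 j) (Finset.mem_univ k)⟩
  have hge : s f (fun _ => 1 / K) ≤ W f := hWlub.1 ⟨_, fun _ => hu0, husum, rfl⟩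
  have hle : ∀ k, -ψ (1 / K) ≤ (f k - 1 / K) * dψ (f k) - ψ (f k) := by
    intro k
    by_cases h : f k = 1 / K
    · rw [h]; simp
    · exact (bregman_grad_lt ψ dψ hdiff hconv _ _ (hfI k) hu h).le
  have hconst : ∑ _k : Fin K, -ψ (1 / K) = -(K : ℝ) * ψ (1 / K) := by
    simp
  have hlow : -(K : ℝ) * ψ (1 / K) ≤ s f (fun _ => 1 / K) := by
    rw [hs, ← hconst]
    exact Finset.sum_le_sum (fun k _ => hle k)
  refine ⟨hWlub.unique hlub, hlow.trans hge, ?_, ?_⟩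
  · intro h
    by_contra hne
    obtain ⟨k, hk⟩ := Function.ne_iff.mp hne
    have : -(K : ℝ) * ψ (1 / K) < s f (fun _ => 1 / K) := by
      rw [hs, ← hconst]
      exact Finset.sum_lt_sum (fun k _ => hle k)
        ⟨k, Finset.mem_univ k, bregman_grad_lt ψ dψ hdiff hconv _ _ (hfI k) hu hk⟩
    linarith
  · intro h
    apply le_antisymm _ (hlow.trans hge)
    apply hWlub.2
    rintro r ⟨t, _, ht1, rfl⟩
    apply le_of_eq
    rw [hs, ← hconst, h, Finset.sum_sub_distrib, ← Finset.sum_mul, Finset.sum_sub_distrib, ht1,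
      husum]
    simp
end

section
/- Let (X, 𝒜, μ) be a probability space, let B ∈ 𝒜 (the out-of-domain region) with complement A = X \ B (the in-domain region), let K ≥ 1, and let ψ : ℝ → ℝ be continuously differentiable and strictly convex on [0, 1]. Fix a measurable in-domain model q : X → Δ_K, and let 𝒫 be the class of measurable maps p : X → Δ_K with p(x) = q(x) for μ-almost every x ∈ A. For p ∈ 𝒫 define the worst-case risk R(p) = sup over measurable t : X → Δ_K of ∫_X s_ψ(p(x), t(x)) dμ(x), where s_ψ(f, t) = ∑_{k=1}^K [(f_k − t_k)ψ'(f_k) − ψ(f_k)]. Define p̂ ∈ 𝒫 by p̂(x) = q(x) for x ∈ A and p̂(x) = the uniform distribution (1/K, …, 1/K) for x ∈ B. Then p̂ minimizes R over 𝒫, and any p ∈ 𝒫 with R(p) = R(p̂) satisfies p(x) = p̂(x) for μ-almost every x ∈ B. -/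
open Finset MeasureTheory
open scoped Classical

theorem aux_tangent (ψ dψ : ℝ → ℝ)
    (hdiff : ∀ x ∈ Set.Icc (0:ℝ) 1, HasDerivWithinAt ψ (dψ x) (Set.Icc (0:ℝ) 1) x)
    (hconv : StrictConvexOn ℝ (Set.Icc (0:ℝ) 1) ψ) (f t : ℝ)
    (hf : f ∈ Set.Icc (0:ℝ) 1) (ht : t ∈ Set.Icc (0:ℝ) 1) (hne : f ≠ t) :
    -ψ t < (f - t) * dψ f - ψ f := by
  rcases lt_or_gt_of_ne hne with h | h
  · have := hconv.lt_slope_of_hasDerivWithinAt hf ht h (hdiff f hf)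
    rw [slope_def_field, lt_div_iff₀ (by linarith)] at this
    linarith
  · have := hconv.slope_lt_of_hasDerivWithinAt ht hf h (hdiff f hf)
    rw [slope_def_field, div_lt_iff₀ (by linarith)] at this
    linarith

theorem aux_mem {K : ℕ} (f : Fin K → ℝ) (hf : (∀ k, 0 ≤ f k) ∧ ∑ k, f k = 1) (k : Fin K) :
    f k ∈ Set.Icc (0:ℝ) 1 :=
  ⟨hf.1 k, hf.2 ▸ Finset.single_le_sum (f := f) (fun i _ => hf.1 i) (Finset.mem_univ k)⟩

theorem aux_meas {X : Type*} [MeasurableSpace X] (g : ℝ → ℝ)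
    (hg : ContinuousOn g (Set.Icc (0:ℝ) 1)) (f : X → ℝ) (hf : Measurable f)
    (hm : ∀ x, f x ∈ Set.Icc (0:ℝ) 1) : Measurable (fun x => g (f x)) := by
  have h1 : Measurable ((Set.Icc (0:ℝ) 1).domRestrict g) :=
    (continuousOn_iff_continuous_domRestrict.1 hg).measurable
  exact h1.comp (hf.subtype_mk (h := hm))

/-- **Proposition 1 / Equation (13): minimax-optimal predictive distribution.**
Let `(X, 𝒜, μ)` be a probability space, `B` a measurable (out-of-domain) set with
in-domain complement `A = Bᶜ`, `K ≥ 1`, and `ψ : ℝ → ℝ` continuously differentiable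
(with derivative `dψ`) and strictly convex on `[0,1]`. Fix a measurable in-domain model
`q : X → Δ_K` and consider the class `𝒫` of measurable simplex-valued `p` agreeing with
`q` μ-a.e. on `A`. For `p ∈ 𝒫`, the worst-case Bregman risk is
`R p = sup { ∫ s (p x) (t x) ∂μ : t : X → Δ_K measurable }` where
`s f t = ∑ k, ((f k - t k) * dψ (f k) - ψ (f k))`. Define `p̂` to equal the uniform
distribution on `B` and `q` off `B`. Then `p̂` minimizes `R` over `𝒫`, and any minimizer
agrees with `p̂` μ-a.e. on `B`. -/
theorem minimax_optimal_predictive_distribution_bregman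
    {X : Type*} [MeasurableSpace X] (μ : Measure X) [IsProbabilityMeasure μ]
    (B : Set X) (hB : MeasurableSet B)
    (K : ℕ) (hK : 1 ≤ K)
    (ψ dψ : ℝ → ℝ)
    (hdiff : ∀ x ∈ Set.Icc (0:ℝ) 1, HasDerivWithinAt ψ (dψ x) (Set.Icc (0:ℝ) 1) x)
    (hcont : ContinuousOn dψ (Set.Icc (0:ℝ) 1))
    (hconv : StrictConvexOn ℝ (Set.Icc (0:ℝ) 1) ψ)
    (q : X → Fin K → ℝ) (hqmeas : Measurable q)
    (hq : ∀ x, (∀ k, 0 ≤ q x k) ∧ ∑ k, q x k = 1)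
    (s : (Fin K → ℝ) → (Fin K → ℝ) → ℝ)
    (hs : ∀ f t, s f t = ∑ k, ((f k - t k) * dψ (f k) - ψ (f k)))
    (R : (X → Fin K → ℝ) → ℝ)
    (hR : ∀ p, R p =
      sSup {r | ∃ t : X → Fin K → ℝ, Measurable t ∧
          (∀ x, (∀ k, 0 ≤ t x k) ∧ ∑ k, t x k = 1) ∧
          r = ∫ x, s (p x) (t x) ∂μ})
    (phat : X → Fin K → ℝ)
    (hphat : ∀ x, phat x = if x ∈ B then (fun _ => 1 / (K : ℝ)) else q x) :
    ∀ p : X → Fin K → ℝ, Measurable p →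
      (∀ x, (∀ k, 0 ≤ p x k) ∧ ∑ k, p x k = 1) →
      (∀ᵐ x ∂μ, x ∉ B → p x = q x) →
      R phat ≤ R p ∧ (R p = R phat → ∀ᵐ x ∂μ, x ∈ B → p x = phat x) := by
  have hψc : ContinuousOn ψ (Set.Icc (0:ℝ) 1) := fun x hx => (hdiff x hx).continuousWithinAt
  obtain ⟨M1, hM1⟩ := isCompact_Icc.exists_bound_of_continuousOn hψc
  obtain ⟨M2, hM2⟩ := isCompact_Icc.exists_bound_of_continuousOn hcont
  have hK0 : (K:ℝ) ≠ 0 := by positivity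
  have hbd : ∀ f t : Fin K → ℝ, ((∀ k, 0 ≤ f k) ∧ ∑ k, f k = 1) →
      ((∀ k, 0 ≤ t k) ∧ ∑ k, t k = 1) → ‖s f t‖ ≤ ∑ k : Fin K, (M2 + M1) := by
    intro f t hf ht
    rw [hs]
    refine norm_sum_le_of_le _ fun k _ => ?_
    have a := aux_mem f hf k
    have b := aux_mem t ht k
    refine (norm_sub_le _ _).trans (add_le_add ?_ (hM1 _ a))
    rw [norm_mul]
    have h1 : ‖f k - t k‖ ≤ 1 := by
      rw [Real.norm_eq_abs, abs_le]; constructor <;> linarith [a.1, a.2, b.1, b.2]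
    calc _ ≤ 1 * M2 := mul_le_mul h1 (hM2 _ a) (norm_nonneg _) zero_le_one
      _ = M2 := one_mul _
  have hint : ∀ f t : X → Fin K → ℝ, Measurable f → Measurable t →
      (∀ x, (∀ k, 0 ≤ f x k) ∧ ∑ k, f x k = 1) →
      (∀ x, (∀ k, 0 ≤ t x k) ∧ ∑ k, t x k = 1) →
      Integrable (fun x => s (f x) (t x)) μ := by
    intro f t hfm htm hf ht
    refine Integrable.of_bound (C := ∑ k : Fin K, (M2 + M1)) ?_
      (Filter.Eventually.of_forall fun x => hbd _ _ (hf x) (ht x))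
    apply Measurable.aestronglyMeasurable
    simp only [hs]
    refine Finset.measurable_sum _ fun k _ => ?_
    have a : Measurable fun x => f x k := (measurable_pi_apply k).comp hfm
    have b : Measurable fun x => t x k := (measurable_pi_apply k).comp htm
    exact ((a.sub b).mul (aux_meas dψ hcont _ a fun x => aux_mem _ (hf x) k)).sub
      (aux_meas ψ hψc _ a fun x => aux_mem _ (hf x) k)
  intro p hpm hp hpq
  set u : Fin K → ℝ := fun _ => 1 / (K:ℝ) with hu
  have hus : (∀ k, 0 ≤ u k) ∧ ∑ k, u k = 1 := by
    refine ⟨fun k => by simp only [hu]; positivity, ?_⟩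
    simp [hu, hK0]
  have hconst : ∀ t : Fin K → ℝ, ((∀ k, 0 ≤ t k) ∧ ∑ k, t k = 1) → s u t = s u u := by
    intro t ht
    simp only [hs, Finset.sum_sub_distrib, sub_mul, hu, ← Finset.sum_mul]
    have h2 : ∑ _k : Fin K, 1 / (K:ℝ) = 1 := hus.2
    rw [ht.2, h2]
  have huu : s u u = ∑ k, -ψ (u k) := by simp [hs]
  have hle : ∀ f : Fin K → ℝ, ((∀ k, 0 ≤ f k) ∧ ∑ k, f k = 1) → s u u ≤ s f u := by
    intro f hf
    rw [huu, hs]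
    refine Finset.sum_le_sum fun k _ => ?_
    by_cases h : f k = u k
    · rw [h]; simp
    · exact (aux_tangent ψ dψ hdiff hconv _ _ (aux_mem f hf k) (aux_mem u hus k) h).le
  have hlt : ∀ f : Fin K → ℝ, ((∀ k, 0 ≤ f k) ∧ ∑ k, f k = 1) → f ≠ u → s u u < s f u := by
    intro f hf hne
    obtain ⟨j, hj⟩ := Function.ne_iff.1 hne
    rw [huu, hs]
    refine Finset.sum_lt_sum (fun k _ => ?_) ⟨j, Finset.mem_univ j,
      aux_tangent ψ dψ hdiff hconv _ _ (aux_mem f hf j) (aux_mem u hus j) hj⟩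
    by_cases h : f k = u k
    · rw [h]; simp
    · exact (aux_tangent ψ dψ hdiff hconv _ _ (aux_mem f hf k) (aux_mem u hus k) h).le
  have hswm : ∀ t : X → Fin K → ℝ, Measurable t →
      Measurable (fun x => if x ∈ B then u else t x) := fun t ht =>
    Measurable.ite hB measurable_const ht
  have hsws : ∀ t : X → Fin K → ℝ, (∀ x, (∀ k, 0 ≤ t x k) ∧ ∑ k, t x k = 1) →
      ∀ x, (∀ k, 0 ≤ (if x ∈ B then u else t x) k) ∧
        ∑ k, (if x ∈ B then u else t x) k = 1 := by
    intro t ht x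
    by_cases h : x ∈ B
    · simp only [if_pos h]; exact hus
    · simp only [if_neg h]; exact ht x
  have hph : phat = fun x => if x ∈ B then u else q x := funext hphat
  have hphm : Measurable phat := hph ▸ hswm q hqmeas
  have hphs : ∀ x, (∀ k, 0 ≤ phat x k) ∧ ∑ k, phat x k = 1 := by
    rw [hph]; exact hsws q hq
  set G : X → ℝ := fun x => if x ∈ B then s (p x) u - s u u else 0 with hG
  have hG0 : ∀ x, 0 ≤ G x := by
    intro x
    simp only [hG]
    split_ifs
    · linarith [hle (p x) (hp x)]
    · exact le_rfl
  have key : ∀ t : X → Fin K → ℝ, (∀ x, (∀ k, 0 ≤ t x k) ∧ ∑ k, t x k = 1) →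
      ∀ᵐ x ∂μ, s (p x) (if x ∈ B then u else t x) = s (phat x) (t x) + G x := by
    intro t ht
    filter_upwards [hpq] with x hx
    rw [hph]
    by_cases h : x ∈ B
    · simp only [hG, if_pos h]
      rw [hconst _ (ht x)]; ring
    · simp only [hG, if_neg h]
      rw [hx h]; ring
  have hGint : Integrable G μ := by
    refine ((hint p _ hpm (hswm q hqmeas) hp (hsws q hq)).sub
      (hint phat q hphm hqmeas hphs hq)).congr ?_
    filter_upwards [key q hq] with x hx
    simp only [Pi.sub_apply]
    rw [hx]; ring
  have hbdd : BddAbove {r | ∃ t : X → Fin K → ℝ, Measurable t ∧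
          (∀ x, (∀ k, 0 ≤ t x k) ∧ ∑ k, t x k = 1) ∧
          r = ∫ x, s (p x) (t x) ∂μ} := by
    refine ⟨∑ k : Fin K, (M2 + M1), ?_⟩
    rintro r ⟨t, htm, ht, rfl⟩
    have h1 := integral_mono (hint p t hpm htm hp ht)
      (integrable_const (μ := μ) (∑ k : Fin K, (M2 + M1)))
      (fun x => (le_abs_self _).trans (hbd _ _ (hp x) (ht x)))
    simpa using h1
  have hmain : R phat + ∫ x, G x ∂μ ≤ R p := by
    rw [← le_sub_iff_add_le, hR phat]
    refine csSup_le ⟨_, q, hqmeas, hq, rfl⟩ ?_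
    rintro r ⟨t, htm, ht, rfl⟩
    rw [le_sub_iff_add_le, ← integral_add (hint phat t hphm htm hphs ht) hGint,
      ← integral_congr_ae (key t ht), hR p]
    exact le_csSup hbdd ⟨_, hswm t htm, hsws t ht, rfl⟩
  have hGi0 : 0 ≤ ∫ x, G x ∂μ := integral_nonneg hG0
  refine ⟨by linarith, fun heq => ?_⟩
  have hz : ∫ x, G x ∂μ = 0 := by linarith
  have hae := (integral_eq_zero_iff_of_nonneg hG0 hGint).1 hz
  filter_upwards [hae] with x hx hxB
  rw [hphat, if_pos hxB]
  by_contra hne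
  have := hlt (p x) (hp x) hne
  simp only [hG, if_pos hxB, Pi.zero_apply] at hx
  linarith
end

section
/- Let (X, 𝒜, μ) be a probability space, let B ∈ 𝒜 with complement A = X \ B, and let K ≥ 1. Fix a measurable in-domain model q : X → Δ_K, and let 𝒫 be the class of measurable maps p : X → Δ_K with p(x) = q(x) for μ-almost every x ∈ A. For p ∈ 𝒫 define the worst-case Brier risk R(p) = sup over measurable t : X → Δ_K of ∫_X ∑_{k=1}^K t_k(x)·‖p(x) − e_k‖² dμ(x), where ‖p − e_k‖² = ∑_{j=1}^K (p_j − δ_{jk})². Define p̂ ∈ 𝒫 by p̂(x) = q(x) for x ∈ A and p̂(x) = the uniform distribution for x ∈ B. Then R(p̂) ≤ R(p) for every p ∈ 𝒫, with R(p̂) = R(p) only if p(x) = p̂(x) for μ-almost every x ∈ B; moreover R(p̂) = ∫_A max_{k} ‖q(x) − e_k‖² dμ(x) + μ(B)·(K − 1)/K. -/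
open Finset MeasureTheory
open scoped Classical

theorem aux_brier_eq {K : ℕ} (v : Fin K → ℝ) (h1 : ∑ k, v k = 1) (k : Fin K) :
    ∑ j, (v j - if j = k then (1:ℝ) else 0) ^ 2 = ∑ j, v j ^ 2 - 2 * v k + 1 := by
  have : ∀ j, (v j - if j = k then (1:ℝ) else 0) ^ 2
      = v j ^ 2 - (if j = k then 2 * v j else 0) + (if j = k then 1 else 0) := by
    intro j
    split_ifs <;> ring
  simp only [this, Finset.sum_add_distrib, Finset.sum_sub_distrib, Finset.sum_ite_eq',
    Finset.mem_univ, if_true]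

theorem aux_brier_bound {K : ℕ} (v : Fin K → ℝ) (h0 : ∀ k, 0 ≤ v k) (h1 : ∑ k, v k = 1)
    (k : Fin K) : ∑ j, (v j - if j = k then (1:ℝ) else 0) ^ 2 ≤ 2 := by
  rw [aux_brier_eq v h1]
  have hle : ∀ j, v j ≤ 1 := fun j => by
    rw [← h1]; exact Finset.single_le_sum (fun i _ => h0 i) (Finset.mem_univ j)
  have : ∑ j, v j ^ 2 ≤ ∑ j, v j :=
    Finset.sum_le_sum fun j _ => by nlinarith [h0 j, hle j]
  linarith [h0 k]

theorem aux_max_ge {K : ℕ} (hK : 1 ≤ K) (v : Fin K → ℝ) (h1 : ∑ k, v k = 1) (M : ℝ)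
    (hM : ∀ k, ∑ j, (v j - if j = k then (1:ℝ) else 0) ^ 2 ≤ M) :
    ((K : ℝ) - 1) / K + ∑ j, (v j - 1 / (K:ℝ)) ^ 2 ≤ M := by
  have hK0 : (0:ℝ) < K := by exact_mod_cast hK
  have hs : ∑ k : Fin K, (∑ j, v j ^ 2 - 2 * v k + 1) ≤ ∑ k : Fin K, M :=
    Finset.sum_le_sum fun k _ => by rw [← aux_brier_eq v h1]; exact hM k
  simp only [Finset.sum_add_distrib, Finset.sum_sub_distrib, ← Finset.mul_sum, h1,
    Finset.sum_const, Finset.card_univ, Fintype.card_fin, nsmul_eq_mul] at hs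
  have he : ∑ j, (v j - 1 / (K:ℝ)) ^ 2 = ∑ j, v j ^ 2 - 1 / K := by
    have : ∀ j, (v j - 1 / (K:ℝ)) ^ 2 = v j ^ 2 - 2 / K * v j + 1 / K ^ 2 := by
      intro j; ring
    simp only [this, Finset.sum_add_distrib, Finset.sum_sub_distrib, ← Finset.mul_sum, h1,
      Finset.sum_const, Finset.card_univ, Fintype.card_fin, nsmul_eq_mul]
    field_simp
    ring
  rw [he]
  have : ((K:ℝ) - 1) / K + (∑ j, v j ^ 2 - 1 / K) = (K * ∑ j, v j ^ 2 - 2 * 1 + K * 1) / K := by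
    field_simp
    ring
  rw [this, div_le_iff₀ hK0]
  linarith

theorem aux_unif {K : ℕ} (hK : 1 ≤ K) (k : Fin K) :
    ∑ j : Fin K, (1 / (K:ℝ) - if j = k then (1:ℝ) else 0) ^ 2 = ((K : ℝ) - 1) / K := by
  have hK0 : (0:ℝ) < K := by exact_mod_cast hK
  have := aux_brier_eq (fun _ : Fin K => 1 / (K:ℝ)) (by simp [hK0.ne']) k
  rw [this]
  simp only [Finset.sum_const, Finset.card_univ, Fintype.card_fin, nsmul_eq_mul]
  field_simp
  ring

theorem aux_sup {X : Type*} [MeasurableSpace X] (μ : Measure X) [IsProbabilityMeasure μ]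
    {K : ℕ} (b : X → Fin K → ℝ) (hb : ∀ k, Measurable fun x => b x k)
    (C : ℝ) (hb0 : ∀ x k, 0 ≤ b x k) (hbC : ∀ x k, b x k ≤ C)
    (M : X → ℝ) (hMm : Measurable M) (hM : ∀ x k, b x k ≤ M x) (hMe : ∀ x, ∃ k, b x k = M x) :
    Integrable M μ ∧ sSup {r | ∃ t : X → Fin K → ℝ, Measurable t ∧
          (∀ x, (∀ k, 0 ≤ t x k) ∧ ∑ k, t x k = 1) ∧
          r = ∫ x, ∑ k, t x k * b x k ∂μ} = ∫ x, M x ∂μ := by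
  have hM0 : ∀ x, 0 ≤ M x := fun x => by
    obtain ⟨k, hk⟩ := hMe x; rw [← hk]; exact hb0 x k
  have hMi : Integrable M μ := by
    refine Integrable.of_bound hMm.aestronglyMeasurable C (.of_forall fun x => ?_)
    obtain ⟨k, hk⟩ := hMe x
    rw [Real.norm_of_nonneg (hM0 x), ← hk]; exact hbC x k
  refine ⟨hMi, IsGreatest.csSup_eq ⟨?_, ?_⟩⟩
  · let c : X → Fin K → ℝ := fun x k => if b x k = M x then 1 else 0
    have hc0 : ∀ x k, 0 ≤ c x k := fun x k => by simp only [c]; split_ifs <;> norm_num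
    have hcm : ∀ k, Measurable fun x => c x k := fun k =>
      Measurable.ite (measurableSet_eq_fun (hb k) hMm) measurable_const measurable_const
    have hN : ∀ x, 0 < ∑ k, c x k := fun x => by
      obtain ⟨k, hk⟩ := hMe x
      refine Finset.sum_pos' (fun i _ => hc0 x i) ⟨k, Finset.mem_univ k, ?_⟩
      simp [c, hk]
    have hcb : ∀ x k, c x k * b x k = c x k * M x := fun x k => by
      simp only [c]; split_ifs with h <;> simp [h]
    refine ⟨fun x k => c x k / ∑ j, c x j, ?_, fun x => ⟨fun k => ?_, ?_⟩, ?_⟩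
    · exact measurable_pi_lambda _ fun k =>
        (hcm k).div (Finset.measurable_sum _ fun j _ => hcm j)
    · exact div_nonneg (hc0 x k) (hN x).le
    · rw [← Finset.sum_div, div_self (hN x).ne']
    · refine integral_congr_ae (.of_forall fun x => ?_)
      have : ∀ k, c x k / (∑ j, c x j) * b x k = c x k / (∑ j, c x j) * M x := fun k => by
        rw [div_mul_eq_mul_div, hcb, div_mul_eq_mul_div]
      simp only [this]
      rw [← Finset.sum_mul, ← Finset.sum_div, div_self (hN x).ne', one_mul]
  · rintro r ⟨t, -, ht, rfl⟩
    refine integral_mono_of_nonneg (.of_forall fun x => ?_) hMi (.of_forall fun x => ?_)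
    · exact Finset.sum_nonneg fun k _ => mul_nonneg ((ht x).1 k) (hb0 x k)
    · calc ∑ k, t x k * b x k ≤ ∑ k, t x k * M x :=
            Finset.sum_le_sum fun k _ => mul_le_mul_of_nonneg_left (hM x k) ((ht x).1 k)
        _ = M x := by rw [← Finset.sum_mul, (ht x).2, one_mul]

/-- **Proposition 1 for the Brier score.**
Let `(X, 𝒜, μ)` be a probability space, `B` a measurable (out-of-domain) set with
in-domain complement `A = Bᶜ`, and `K ≥ 1`. Fix a measurable in-domain model
`q : X → Δ_K` and consider the class `𝒫` of measurable simplex-valued `p` agreeing with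
`q` μ-a.e. on `A`. For `p ∈ 𝒫`, the worst-case Brier risk is
`R p = sup { ∫ ∑ k, t x k * ‖p x - e k‖² ∂μ : t : X → Δ_K measurable }` where
`‖p - e k‖² = ∑ j, (p j - δ_{jk})²`. Define `p̂` to be uniform on `B` and equal to `q`
off `B`. Then `R p̂ ≤ R p` for all `p ∈ 𝒫`, with equality only if `p = p̂` μ-a.e. on `B`;
moreover `R p̂ = ∫_{Bᶜ} max_k ‖q x - e k‖² ∂μ + μ(B) * (K - 1)/K`. -/
theorem minimax_optimal_predictive_distribution_brier
    {X : Type*} [MeasurableSpace X] (μ : Measure X) [IsProbabilityMeasure μ]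
    (B : Set X) (hB : MeasurableSet B)
    (K : ℕ) (hK : 1 ≤ K)
    (q : X → Fin K → ℝ) (hqmeas : Measurable q)
    (hq : ∀ x, (∀ k, 0 ≤ q x k) ∧ ∑ k, q x k = 1)
    (Br : (Fin K → ℝ) → Fin K → ℝ)
    (hBr : ∀ p k, Br p k = ∑ j, (p j - if j = k then (1:ℝ) else 0) ^ 2)
    (R : (X → Fin K → ℝ) → ℝ)
    (hR : ∀ p, R p =
      sSup {r | ∃ t : X → Fin K → ℝ, Measurable t ∧
          (∀ x, (∀ k, 0 ≤ t x k) ∧ ∑ k, t x k = 1) ∧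
          r = ∫ x, ∑ k, t x k * Br (p x) k ∂μ})
    (phat : X → Fin K → ℝ)
    (hphat : ∀ x, phat x = if x ∈ B then (fun _ => 1 / (K : ℝ)) else q x) :
    (∀ p : X → Fin K → ℝ, Measurable p →
      (∀ x, (∀ k, 0 ≤ p x k) ∧ ∑ k, p x k = 1) →
      (∀ᵐ x ∂μ, x ∉ B → p x = q x) →
      R phat ≤ R p ∧ (R phat = R p → ∀ᵐ x ∂μ, x ∈ B → p x = phat x)) ∧
    R phat =
      (∫ x in Bᶜ, Finset.univ.sup' ⟨⟨0, hK⟩, Finset.mem_univ _⟩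
          (fun k => Br (q x) k) ∂μ) +
        (μ B).toReal * (((K : ℝ) - 1) / K) := by
  have hK0 : (0:ℝ) < K := by exact_mod_cast hK
  have hne : (Finset.univ : Finset (Fin K)).Nonempty := ⟨⟨0, hK⟩, Finset.mem_univ _⟩
  let M : (Fin K → ℝ) → ℝ := fun v => Finset.univ.sup' hne (fun k => Br v k)
  have hMle : ∀ v k, Br v k ≤ M v := fun v k =>
    Finset.le_sup' (fun k => Br v k) (Finset.mem_univ k)
  have hMex : ∀ v, ∃ k, Br v k = M v := fun v => by
    obtain ⟨k, -, hk⟩ := Finset.exists_mem_eq_sup' hne (fun k => Br v k)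
    exact ⟨k, hk.symm⟩
  have hBrm : ∀ k, Measurable fun v => Br v k := fun k => by
    simp only [hBr]
    fun_prop
  have hMm : Measurable M := by
    have := Finset.measurable_sup' (s := Finset.univ) hne
      (f := fun k (v : Fin K → ℝ) => Br v k) (fun k _ => hBrm k)
    convert this using 1
    ext v
    simp [M, Finset.sup'_apply]
  have key : ∀ p : X → Fin K → ℝ, Measurable p →
      (∀ x, (∀ k, 0 ≤ p x k) ∧ ∑ k, p x k = 1) →
      Integrable (fun x => M (p x)) μ ∧ R p = ∫ x, M (p x) ∂μ := by
    intro p hpm hp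
    rw [hR]
    refine aux_sup μ (fun x k => Br (p x) k) (fun k => (hBrm k).comp hpm) 2 (fun x k => ?_)
      (fun x k => ?_) (fun x => M (p x)) (hMm.comp hpm) (fun x k => hMle _ k) (fun x => hMex _)
    · simp only [hBr]; positivity
    · simp only [hBr]; exact aux_brier_bound _ (hp x).1 (hp x).2 k
  have hMu : M (fun _ => 1 / (K:ℝ)) = ((K:ℝ) - 1) / K := by
    obtain ⟨k, hk⟩ := hMex (fun _ => 1 / (K:ℝ))
    rw [← hk, hBr]; exact aux_unif hK k
  have hMg : ∀ v : Fin K → ℝ, ∑ k, v k = 1 →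
      ((K:ℝ) - 1) / K + ∑ j, (v j - 1 / (K:ℝ)) ^ 2 ≤ M v := fun v hv =>
    aux_max_ge hK v hv (M v) fun k => by rw [← hBr]; exact hMle v k
  have hphm : Measurable phat := by
    have : phat = fun x => if x ∈ B then (fun _ => 1 / (K : ℝ)) else q x := funext hphat
    rw [this]
    exact Measurable.ite hB measurable_const hqmeas
  have hphs : ∀ x, (∀ k, 0 ≤ phat x k) ∧ ∑ k, phat x k = 1 := by
    intro x
    rw [hphat]
    split_ifs
    · exact ⟨fun k => by positivity, by simp [hK0.ne']⟩
    · exact hq x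
  obtain ⟨hi, hRh⟩ := key phat hphm hphs
  refine ⟨?_, ?_⟩
  · intro p hpm hp hpq
    obtain ⟨hip, hRp⟩ := key p hpm hp
    have hle : ∀ᵐ x ∂μ, M (phat x) ≤ M (p x) := by
      filter_upwards [hpq] with x hx
      rw [hphat]
      split_ifs with h
      · rw [hMu]
        have := hMg (p x) (hp x).2
        have h2 : 0 ≤ ∑ j, (p x j - 1 / (K:ℝ)) ^ 2 := by positivity
        linarith
      · rw [hx h]
    rw [hRh, hRp]
    refine ⟨integral_mono_ae hi hip hle, fun heq => ?_⟩
    have hae := (integral_eq_iff_of_ae_le hi hip hle).1 heq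
    filter_upwards [hae] with x hx hxB
    have hx' : M (phat x) = M (p x) := hx
    rw [hphat, if_pos hxB] at hx' ⊢
    rw [hMu] at hx'
    have := hMg (p x) (hp x).2
    have h2 : ∑ j, (p x j - 1 / (K:ℝ)) ^ 2 = 0 :=
      le_antisymm (by linarith) (by positivity)
    rw [Finset.sum_eq_zero_iff_of_nonneg (fun j _ => sq_nonneg _)] at h2
    ext j
    have := h2 j (Finset.mem_univ j)
    exact sub_eq_zero.1 (pow_eq_zero_iff (two_ne_zero) |>.1 this)
  · rw [hRh, ← integral_add_compl hB hi, add_comm]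
    congr 1
    · refine setIntegral_congr_fun hB.compl fun x hx => ?_
      have hx' : x ∉ B := hx
      simp only [hphat, if_neg hx', M]
    · rw [setIntegral_congr_fun (g := fun _ => ((K:ℝ) - 1) / K) hB fun x hx => ?_]
      · simp [Measure.real]
      · simp only [hphat, if_pos hx, hMu]
end
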